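/- Let N be a Hermitian 4×4 complex matrix (indexed by pairs, with Kronecker-product index convention), and let M₀ = (σ_I+σ_X)/6, M₁ = (σ_I−σ_X)/6, M₂ = (σ_I+σ_Y)/6, M₃ = (σ_I−σ_Y)/6, M₄ = (σ_I+σ_Z)/6, M₅ = (σ_I−σ_Z)/6. Define x(i,j) = tr(N·(M_i ⊗ M_j)) for 0 ≤ i,j ≤ 5 (these are real numbers). Then ∑_{i,j=0}^{5} x(i,j)² = ((tr N)² + ‖tr₂(N)‖₂² + ‖tr₁(N)‖₂² + ‖N‖₂²)/81. Moreover, if in addition N is positive semidefinite with tr N = 1, then sqrt(∑_{i,j} x(i,j)²) ≤ 2/9. -/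

import Mathlib

open Matrix Complex
open scoped Kronecker ComplexOrder

/-- The Pauli matrix σ_I. -/
def sigmaI : Matrix (Fin 2) (Fin 2) ℂ := !![1, 0; 0, 1]

/-- The Pauli matrix σ_X. -/
def sigmaX : Matrix (Fin 2) (Fin 2) ℂ := !![0, 1; 1, 0]

/-- The Pauli matrix σ_Y (with the paper's convention σ_Y = [[0,i],[-i,0]]). -/
def sigmaY : Matrix (Fin 2) (Fin 2) ℂ := !![0, I; -I, 0]

/-- The Pauli matrix σ_Z. -/
def sigmaZ : Matrix (Fin 2) (Fin 2) ℂ := !![1, 0; 0, -1]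

/-- The six elements of the POVM ℳ = (1/6){σ_I±σ_X, σ_I±σ_Y, σ_I±σ_Z}. -/
noncomputable def povmM : Fin 6 → Matrix (Fin 2) (Fin 2) ℂ :=
  ![(6 : ℂ)⁻¹ • (sigmaI + sigmaX), (6 : ℂ)⁻¹ • (sigmaI - sigmaX),
    (6 : ℂ)⁻¹ • (sigmaI + sigmaY), (6 : ℂ)⁻¹ • (sigmaI - sigmaY),
    (6 : ℂ)⁻¹ • (sigmaI + sigmaZ), (6 : ℂ)⁻¹ • (sigmaI - sigmaZ)]

/-- The partial trace over the second tensor factor. -/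
noncomputable def partialTrace₂ (A : Matrix (Fin 2 × Fin 2) (Fin 2 × Fin 2) ℂ) :
    Matrix (Fin 2) (Fin 2) ℂ :=
  fun i j => ∑ k : Fin 2, A (i, k) (j, k)

/-- The partial trace over the first tensor factor. -/
noncomputable def partialTrace₁ (A : Matrix (Fin 2 × Fin 2) (Fin 2 × Fin 2) ℂ) :
    Matrix (Fin 2) (Fin 2) ℂ :=
  fun k l => ∑ i : Fin 2, A (i, k) (i, l)

lemma psd_frob {n : Type*} [Fintype n] (A : Matrix n n ℂ) (hA : A.PosSemidef) :
    ∑ i, ∑ j, ‖A i j‖ ^ 2 ≤ A.trace.re ^ 2 := by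
  have h : ∀ i j, ‖A i j‖ ^ 2 ≤ (A i i).re * (A j j).re := by
    intro i j
    have h1 := (hA.submatrix ![i, j]).det_nonneg
    rw [Matrix.det_fin_two] at h1
    simp only [Matrix.submatrix_apply, Matrix.cons_val_zero, Matrix.cons_val_one] at h1
    have h2 : A j i = star (A i j) := (hA.1.apply j i).symm
    have h3 : (A i i).im = 0 := Complex.conj_eq_iff_im.mp (hA.1.apply i i)
    have h4 := (Complex.le_def.mp h1).1
    rw [h2] at h4
    simp [h3] at h4
    rw [Complex.sq_norm, Complex.normSq_apply]
    linarith
  calc _ ≤ ∑ i, ∑ j, (A i i).re * (A j j).re :=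
        Finset.sum_le_sum fun i _ => Finset.sum_le_sum fun j _ => h i j
    _ = _ := by
        rw [← Finset.sum_mul_sum, Matrix.trace, Complex.re_sum, sq]
        rfl

lemma psd_pt2 (A : Matrix (Fin 2 × Fin 2) (Fin 2 × Fin 2) ℂ) (hA : A.PosSemidef) :
    (partialTrace₂ A).PosSemidef := by
  have : partialTrace₂ A = A.submatrix (fun i => (i, 0)) (fun i => (i, 0))
      + A.submatrix (fun i => (i, 1)) (fun i => (i, 1)) := by
    ext i j; simp [partialTrace₂]
  rw [this]
  exact (hA.submatrix _).add (hA.submatrix _)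

lemma psd_pt1 (A : Matrix (Fin 2 × Fin 2) (Fin 2 × Fin 2) ℂ) (hA : A.PosSemidef) :
    (partialTrace₁ A).PosSemidef := by
  have : partialTrace₁ A = A.submatrix (fun i => (0, i)) (fun i => (0, i))
      + A.submatrix (fun i => (1, i)) (fun i => (1, i)) := by
    ext i j; simp [partialTrace₁]
  rw [this]
  exact (hA.submatrix _).add (hA.submatrix _)

lemma trace_pt2 (A : Matrix (Fin 2 × Fin 2) (Fin 2 × Fin 2) ℂ) :
    (partialTrace₂ A).trace = A.trace := by
  simp [Matrix.trace, partialTrace₂, Fintype.sum_prod_type]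

lemma trace_pt1 (A : Matrix (Fin 2 × Fin 2) (Fin 2 × Fin 2) ℂ) :
    (partialTrace₁ A).trace = A.trace := by
  simp [Matrix.trace, partialTrace₁, Fintype.sum_prod_type]
  ring

set_option maxHeartbeats 4000000 in
/-- Two-qubit case of the paper's Proposition: for a Hermitian 4×4 matrix N, the
ℓ₂ norm of the outcome-probability vector x(i,j) = tr(N(M_i ⊗ M_j)) of the product
POVM ℳ⊗ℳ satisfies ∑ x(i,j)² = ((tr N)² + ‖tr₂N‖₂² + ‖tr₁N‖₂² + ‖N‖₂²)/81;
if moreover N is a quantum state then sqrt(∑ x(i,j)²) ≤ 2/9. -/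
theorem outcome_vector_l2_product_povm
    (N : Matrix (Fin 2 × Fin 2) (Fin 2 × Fin 2) ℂ) (hN : N.IsHermitian)
    (x : Fin 6 → Fin 6 → ℝ)
    (hx : ∀ i j, (x i j : ℂ) = (N * (povmM i ⊗ₖ povmM j)).trace) :
    (∑ i : Fin 6, ∑ j : Fin 6, x i j ^ 2
      = ((N.trace.re) ^ 2
          + (∑ i, ∑ j, ‖partialTrace₂ N i j‖ ^ 2)
          + (∑ k, ∑ l, ‖partialTrace₁ N k l‖ ^ 2)
          + (∑ a, ∑ b, ‖N a b‖ ^ 2)) / 81) ∧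
    (N.PosSemidef → N.trace = 1 →
      Real.sqrt (∑ i : Fin 6, ∑ j : Fin 6, x i j ^ 2) ≤ 2 / 9) := by
  have key : ∑ i : Fin 6, ∑ j : Fin 6, x i j ^ 2
      = ((N.trace.re) ^ 2
          + (∑ i, ∑ j, ‖partialTrace₂ N i j‖ ^ 2)
          + (∑ k, ∑ l, ‖partialTrace₁ N k l‖ ^ 2)
          + (∑ a, ∑ b, ‖N a b‖ ^ 2)) / 81 := by
    have hr : ∀ a b, (N b a).re = (N a b).re := fun a b => by
      rw [← hN.apply a b]; simp
    have hi : ∀ a b, (N b a).im = -(N a b).im := fun a b => by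
      rw [← hN.apply a b]; simp
    have h0 : ∀ a, (N a a).im = 0 := fun a => by linarith [hi a a]
    have hx' : ∀ i j, x i j = ((N * (povmM i ⊗ₖ povmM j)).trace).re := fun i j => by
      rw [← hx i j, Complex.ofReal_re]
    have i6 : ((6 : ℂ)⁻¹) = (((6 : ℝ)⁻¹ : ℝ) : ℂ) := by push_cast; rfl
    simp only [hx', Complex.sq_norm, Complex.normSq_apply]
    simp only [Fin.sum_univ_six, povmM, i6, sigmaI, sigmaX, sigmaY, sigmaZ, Matrix.trace,
      Matrix.diag, Matrix.mul_apply, Matrix.kroneckerMap_apply, Fintype.sum_prod_type,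
      Fin.sum_univ_two, partialTrace₁, partialTrace₂, Matrix.smul_apply, Matrix.add_apply,
      Matrix.sub_apply]
    simp [h0, hr (0,0) (0,1), hr (0,0) (1,0), hr (0,0) (1,1), hr (0,1) (1,0), hr (0,1) (1,1),
      hr (1,0) (1,1), hi (0,0) (0,1), hi (0,0) (1,0), hi (0,0) (1,1), hi (0,1) (1,0),
      hi (0,1) (1,1), hi (1,0) (1,1)]
    ring
  refine ⟨key, fun hP ht => ?_⟩
  rw [key]
  have h1 := psd_frob N hP
  have h2 := psd_frob _ (psd_pt2 N hP)
  have h3 := psd_frob _ (psd_pt1 N hP)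
  rw [trace_pt2] at h2
  rw [trace_pt1] at h3
  rw [ht] at h1 h2 h3 ⊢
  simp only [Complex.one_re] at h1 h2 h3 ⊢
  apply Real.sqrt_le_iff.mpr
  constructor
  · norm_num
  · linarith
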